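/- Let ℓ ≥ 1 be an integer and Φ a smooth function on ℝ^{n+2} ∖ {0} homogeneous of degree ℓ − n/2, i.e. X·∂ Φ = (ℓ − n/2) Φ. Then for all indices A₁, …, A_ℓ, the iterated Thomas-D derivative satisfies D_{A₁} D_{A₂} ⋯ D_{A_ℓ} Φ = (−1)^ℓ X_{A₁} X_{A₂} ⋯ X_{A_ℓ} · □^ℓ Φ. -/

import Mathlib

noncomputable section

/-- Partial derivative in coordinate direction `A` of a function on `ℝ^m`. -/
def pd {m : ℕ} (A : Fin m) (f : (Fin m → ℝ) → ℝ) : (Fin m → ℝ) → ℝ :=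
  fun x => fderiv ℝ f x (Pi.single A 1)

/-- The Euler operator `X·∂`. -/
def euler {m : ℕ} (f : (Fin m → ℝ) → ℝ) : (Fin m → ℝ) → ℝ :=
  fun x => ∑ A, x A * pd A f x

/-- The Laplacian `□ = η^{AB} ∂_A ∂_B` for the diagonal metric with entries `ε`. -/
def lap {m : ℕ} (ε : Fin m → ℝ) (f : (Fin m → ℝ) → ℝ) : (Fin m → ℝ) → ℝ :=
  fun x => ∑ A, ε A * pd A (pd A f) x

/-- `X² = η_{AB} X^A X^B` for the diagonal metric with entries `ε`. -/
def xsq {m : ℕ} (ε : Fin m → ℝ) (x : Fin m → ℝ) : ℝ :=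
  ∑ A, ε A * x A ^ 2

/-- `ε` is a diagonal metric with all entries `±1` and exactly `q` entries equal to `-1`,
i.e. a nondegenerate symmetric bilinear form of signature `(m - q, q)`. -/
def isSig {m : ℕ} (ε : Fin m → ℝ) (q : ℕ) : Prop :=
  (∀ A, ε A = 1 ∨ ε A = -1) ∧ Nat.card {A : Fin m // ε A = -1} = q

/-- The flat Thomas-D operator `D_A = 2(X·∂ + c)∂_A - X_A □` (with `c = n/2`). -/
def thomasD {m : ℕ} (ε : Fin m → ℝ) (c : ℝ) (A : Fin m) (f : (Fin m → ℝ) → ℝ) :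
    (Fin m → ℝ) → ℝ :=
  fun x => 2 * (euler (pd A f) x + c * pd A f x) - ε A * x A * lap ε f x

/-- Iterated Thomas-D derivative `D_{A₁} D_{A₂} ⋯ D_{A_ℓ}` along a list of indices
(the head of the list acts last). -/
def thomasDList {m : ℕ} (ε : Fin m → ℝ) (c : ℝ) :
    List (Fin m) → ((Fin m → ℝ) → ℝ) → (Fin m → ℝ) → ℝ
  | [], f => f
  | A :: As, f => thomasD ε c A (thomasDList ε c As f)

open scoped ContDiff

section Calculus

variable {m : ℕ} {S : Set (Fin m → ℝ)} {f g : (Fin m → ℝ) → ℝ} {x : Fin m → ℝ}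

lemma differentiableAt_of_smoothOn (hS : IsOpen S) (hf : ContDiffOn ℝ ∞ f S) (hx : x ∈ S) :
    DifferentiableAt ℝ f x :=
  (hf.contDiffAt (hS.mem_nhds hx)).differentiableAt (by simp)

lemma pd_congr (hS : IsOpen S) (A : Fin m) (h : Set.EqOn f g S) :
    Set.EqOn (pd A f) (pd A g) S := fun x hx => by
  simp only [pd]
  rw [(h.eventuallyEq_of_mem (hS.mem_nhds hx)).fderiv_eq]

lemma pd_smoothOn (hS : IsOpen S) (A : Fin m) (hf : ContDiffOn ℝ ∞ f S) :
    ContDiffOn ℝ ∞ (pd A f) S :=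
  (hf.fderiv_of_isOpen hS (by simp)).clm_apply contDiffOn_const

lemma pd_sub (A : Fin m) (hf : DifferentiableAt ℝ f x) (hg : DifferentiableAt ℝ g x) :
    pd A (fun y => f y - g y) x = pd A f x - pd A g x := by
  simp [pd, fderiv_fun_sub hf hg]

lemma pd_add (A : Fin m) (hf : DifferentiableAt ℝ f x) (hg : DifferentiableAt ℝ g x) :
    pd A (fun y => f y + g y) x = pd A f x + pd A g x := by
  simp [pd, fderiv_fun_add hf hg]

lemma pd_const_mul (A : Fin m) (a : ℝ) (hf : DifferentiableAt ℝ f x) :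
    pd A (fun y => a * f y) x = a * pd A f x := by
  simp [pd, fderiv_const_mul hf]

lemma pd_sum (A : Fin m) {F : Fin m → (Fin m → ℝ) → ℝ}
    (hF : ∀ B, DifferentiableAt ℝ (F B) x) :
    pd A (fun y => ∑ B, F B y) x = ∑ B, pd A (F B) x := by
  simp [pd, fderiv_fun_sum fun B _ => hF B]

lemma pd_coord_mul (A B : Fin m) (hf : DifferentiableAt ℝ f x) :
    pd A (fun y => y B * f y) x = x B * pd A f x + (if A = B then f x else 0) := by
  have hB : HasFDerivAt (fun y : Fin m → ℝ => y B)
      (ContinuousLinearMap.proj (R := ℝ) (φ := fun _ : Fin m => ℝ) B) x :=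
    (ContinuousLinearMap.proj (R := ℝ) (φ := fun _ : Fin m => ℝ) B).hasFDerivAt
  simp [pd, (hB.fun_mul hf.hasFDerivAt).fderiv, Pi.single_apply, eq_comm]

lemma pd_comm (hS : IsOpen S) (A B : Fin m) (hf : ContDiffOn ℝ ∞ f S) :
    Set.EqOn (pd A (pd B f)) (pd B (pd A f)) S := fun x hx => by
  have hd : DifferentiableAt ℝ (fderiv ℝ f) x :=
    ((hf.fderiv_of_isOpen hS (m := ∞) (by simp)).contDiffAt (hS.mem_nhds hx)).differentiableAt
      (by simp)
  have key : ∀ C D : Fin m,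
      pd C (pd D f) x = fderiv ℝ (fderiv ℝ f) x (Pi.single C 1) (Pi.single D 1) := fun C D => by
    change fderiv ℝ (fun y => fderiv ℝ f y (Pi.single D 1)) x (Pi.single C 1) = _
    rw [fderiv_clm_apply hd (differentiableAt_const _)]
    simp
  rw [key, key]
  refine (hf.contDiffAt (hS.mem_nhds hx)).isSymmSndFDerivAt ?_ _ _
  simp only [minSmoothness_of_isRCLikeNormedField]
  exact WithTop.coe_le_coe.2 le_top

lemma lap_congr (hS : IsOpen S) (ε : Fin m → ℝ) (h : Set.EqOn f g S) :
    Set.EqOn (lap ε f) (lap ε g) S := fun x hx => by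
  simp only [lap]
  exact Finset.sum_congr rfl fun A _ => by rw [pd_congr hS A (pd_congr hS A h) hx]

lemma lap_smoothOn (hS : IsOpen S) (ε : Fin m → ℝ) (hf : ContDiffOn ℝ ∞ f S) :
    ContDiffOn ℝ ∞ (lap ε f) S :=
  ContDiffOn.sum fun A _ => contDiffOn_const.mul (pd_smoothOn hS A (pd_smoothOn hS A hf))

lemma coord_mul_smoothOn (A : Fin m) (hf : ContDiffOn ℝ ∞ f S) :
    ContDiffOn ℝ ∞ (fun y => y A * f y) S :=
  (contDiff_apply ℝ ℝ A).contDiffOn.mul hf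

lemma lap_const_mul (hS : IsOpen S) (ε : Fin m → ℝ) (a : ℝ) (hf : ContDiffOn ℝ ∞ f S) :
    Set.EqOn (lap ε fun y => a * f y) (fun y => a * lap ε f y) S := fun x hx => by
  simp only [lap, Finset.mul_sum]
  refine Finset.sum_congr rfl fun A _ => ?_
  have h : Set.EqOn (pd A fun y => a * f y) (fun y => a * pd A f y) S := fun y hy =>
    pd_const_mul A a (differentiableAt_of_smoothOn hS hf hy)
  rw [pd_congr hS A h hx,
    pd_const_mul A a (differentiableAt_of_smoothOn hS (pd_smoothOn hS A hf) hx)]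
  ring

lemma lap_sub (hS : IsOpen S) (ε : Fin m → ℝ) (hf : ContDiffOn ℝ ∞ f S)
    (hg : ContDiffOn ℝ ∞ g S) :
    Set.EqOn (lap ε fun y => f y - g y) (fun y => lap ε f y - lap ε g y) S := fun x hx => by
  simp only [lap, ← Finset.sum_sub_distrib]
  refine Finset.sum_congr rfl fun A _ => ?_
  have h : Set.EqOn (pd A fun y => f y - g y) (fun y => pd A f y - pd A g y) S := fun y hy =>
    pd_sub A (differentiableAt_of_smoothOn hS hf hy) (differentiableAt_of_smoothOn hS hg hy)
  rw [pd_congr hS A h hx,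
    pd_sub A (differentiableAt_of_smoothOn hS (pd_smoothOn hS A hf) hx)
      (differentiableAt_of_smoothOn hS (pd_smoothOn hS A hg) hx)]
  ring

lemma lap_pd (hS : IsOpen S) (ε : Fin m → ℝ) (A : Fin m) (hf : ContDiffOn ℝ ∞ f S) :
    Set.EqOn (lap ε (pd A f)) (pd A (lap ε f)) S := fun x hx => by
  have hd : ∀ B, DifferentiableAt ℝ (pd B (pd B f)) x := fun B =>
    differentiableAt_of_smoothOn hS (pd_smoothOn hS B (pd_smoothOn hS B hf)) hx
  have h := pd_sum A (x := x) (F := fun B y => ε B * pd B (pd B f) y)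
    fun B => (hd B).const_mul _
  change _ = pd A (fun y => ∑ B, ε B * pd B (pd B f) y) x
  rw [h]
  simp only [lap]
  refine Finset.sum_congr rfl fun B _ => ?_
  rw [pd_const_mul A _ (hd B), pd_congr hS B (pd_comm hS B A hf) hx,
    pd_comm hS B A (pd_smoothOn hS B hf) hx]

lemma lap_coord_mul (hS : IsOpen S) (ε : Fin m → ℝ) (A : Fin m) (hf : ContDiffOn ℝ ∞ f S) :
    Set.EqOn (lap ε fun y => y A * f y) (fun y => y A * lap ε f y + 2 * ε A * pd A f y) S :=
  fun x hx => by
  have key : ∀ B, pd B (pd B fun y => y A * f y) x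
      = x A * pd B (pd B f) x + if B = A then 2 * pd B f x else 0 := fun B => by
    have h : Set.EqOn (pd B fun y => y A * f y)
        (fun y => y A * pd B f y + (if B = A then 1 else 0) * f y) S := fun y hy => by
      rw [pd_coord_mul B A (differentiableAt_of_smoothOn hS hf hy)]
      split_ifs <;> simp
    have hf' := pd_smoothOn hS B hf
    rw [pd_congr hS B h hx,
      pd_add B (differentiableAt_of_smoothOn hS (coord_mul_smoothOn A hf') hx)
        ((differentiableAt_of_smoothOn hS hf hx).const_mul _),
      pd_coord_mul B A (differentiableAt_of_smoothOn hS hf' hx),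
      pd_const_mul B _ (differentiableAt_of_smoothOn hS hf hx)]
    split_ifs <;> ring
  simp only [lap, key, mul_add, Finset.sum_add_distrib, Finset.mul_sum]
  congr 1
  · exact Finset.sum_congr rfl fun B _ => by ring
  · simp
    ring

lemma euler_congr (hS : IsOpen S) (h : Set.EqOn f g S) :
    Set.EqOn (euler f) (euler g) S := fun x hx => by
  simp only [euler]
  exact Finset.sum_congr rfl fun A _ => by rw [pd_congr hS A h hx]

lemma euler_sub (hf : DifferentiableAt ℝ f x) (hg : DifferentiableAt ℝ g x) :
    euler (fun y => f y - g y) x = euler f x - euler g x := by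
  simp [euler, pd_sub _ hf hg, mul_sub]

lemma euler_const_mul (a : ℝ) (hf : DifferentiableAt ℝ f x) :
    euler (fun y => a * f y) x = a * euler f x := by
  simp only [euler, pd_const_mul _ a hf, Finset.mul_sum]
  exact Finset.sum_congr rfl fun A _ => by ring

lemma euler_coord_mul (A : Fin m) (hf : DifferentiableAt ℝ f x) :
    euler (fun y => y A * f y) x = x A * euler f x + x A * f x := by
  simp only [euler, pd_coord_mul _ A hf, mul_add, Finset.sum_add_distrib, Finset.mul_sum]
  congr 1
  · exact Finset.sum_congr rfl fun B _ => by ring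
  · simp

lemma euler_sum {F : Fin m → (Fin m → ℝ) → ℝ} (hF : ∀ B, DifferentiableAt ℝ (F B) x) :
    euler (fun y => ∑ B, F B y) x = ∑ B, euler (F B) x := by
  simp only [euler, pd_sum _ hF, Finset.mul_sum]
  exact Finset.sum_comm

lemma euler_pd (hS : IsOpen S) (A : Fin m) {w : ℝ} (hf : ContDiffOn ℝ ∞ f S)
    (hom : ∀ y ∈ S, euler f y = w * f y) :
    ∀ y ∈ S, euler (pd A f) y = (w - 1) * pd A f y := fun x hx => by
  have hd : ∀ B, DifferentiableAt ℝ (pd B f) x := fun B =>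
    differentiableAt_of_smoothOn hS (pd_smoothOn hS B hf) hx
  have h := pd_sum A (x := x) (F := fun B y => y B * pd B f y) fun B =>
    differentiableAt_of_smoothOn hS (coord_mul_smoothOn B (pd_smoothOn hS B hf)) hx
  have h' := pd_congr hS A (g := fun y => w * f y) hom hx
  rw [pd_const_mul A w (differentiableAt_of_smoothOn hS hf hx)] at h'
  change pd A (fun y => ∑ B, y B * pd B f y) x = _ at h'
  rw [h] at h'
  simp only [pd_coord_mul _ _ (hd _), Finset.sum_add_distrib, Finset.sum_ite_eq,
    Finset.mem_univ, if_true] at h'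
  have e : euler (pd A f) x = ∑ B, x B * pd A (pd B f) x :=
    Finset.sum_congr rfl fun B _ => by rw [pd_comm hS B A hf hx]
  rw [e]
  linarith

lemma euler_lap (hS : IsOpen S) (ε : Fin m → ℝ) {w : ℝ} (hf : ContDiffOn ℝ ∞ f S)
    (hom : ∀ y ∈ S, euler f y = w * f y) :
    ∀ y ∈ S, euler (lap ε f) y = (w - 2) * lap ε f y := fun x hx => by
  have hd : ∀ B, DifferentiableAt ℝ (pd B (pd B f)) x := fun B =>
    differentiableAt_of_smoothOn hS (pd_smoothOn hS B (pd_smoothOn hS B hf)) hx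
  have h := euler_sum (x := x) (F := fun B y => ε B * pd B (pd B f) y)
    fun B => (hd B).const_mul _
  change euler (fun y => ∑ B, ε B * pd B (pd B f) y) x = _
  rw [h]
  simp only [lap, Finset.mul_sum]
  refine Finset.sum_congr rfl fun B _ => ?_
  rw [euler_const_mul _ (hd B),
    euler_pd hS B (pd_smoothOn hS B hf) (euler_pd hS B hf hom) x hx]
  ring

lemma iterate_lap_congr (hS : IsOpen S) (ε : Fin m → ℝ) (k : ℕ) (h : Set.EqOn f g S) :
    Set.EqOn ((lap ε)^[k] f) ((lap ε)^[k] g) S := by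
  induction k with
  | zero => exact h
  | succ k ih =>
    simp only [Function.iterate_succ_apply']
    exact lap_congr hS ε ih

lemma iterate_lap_smoothOn (hS : IsOpen S) (ε : Fin m → ℝ) (k : ℕ)
    (hf : ContDiffOn ℝ ∞ f S) : ContDiffOn ℝ ∞ ((lap ε)^[k] f) S := by
  induction k with
  | zero => exact hf
  | succ k ih =>
    simp only [Function.iterate_succ_apply']
    exact lap_smoothOn hS ε ih

lemma smoothOn_const_mul_pd_sub (hS : IsOpen S) (ε : Fin m → ℝ) (A : Fin m) (a b : ℝ)
    (hf : ContDiffOn ℝ ∞ f S) :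
    ContDiffOn ℝ ∞ (fun y => a * pd A f y - b * (y A * lap ε f y)) S :=
  (contDiffOn_const.mul (pd_smoothOn hS A hf)).sub
    (contDiffOn_const.mul (coord_mul_smoothOn A (lap_smoothOn hS ε hf)))

lemma lap_const_mul_pd_sub (hS : IsOpen S) (ε : Fin m → ℝ) (A : Fin m) (hA : ε A * ε A = 1)
    (a : ℝ) (hf : ContDiffOn ℝ ∞ f S) :
    Set.EqOn (lap ε fun y => a * pd A f y - ε A * (y A * lap ε f y))
      (fun y => (a - 2) * pd A (lap ε f) y - ε A * (y A * lap ε (lap ε f) y)) S := fun x hx => by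
  have h₁ := pd_smoothOn hS A hf
  have h₂ := lap_smoothOn hS ε hf
  have h₃ := coord_mul_smoothOn A h₂
  have e := lap_sub hS ε (contDiffOn_const (c := a).mul h₁) (contDiffOn_const (c := ε A).mul h₃) hx
  simp only [lap_const_mul hS ε _ h₁ hx, lap_const_mul hS ε _ h₃ hx,
    lap_coord_mul hS ε A h₂ hx, lap_pd hS ε A hf hx] at e
  rw [e]
  linear_combination (-2 * pd A (lap ε f) x) * hA

lemma iterate_lap_const_mul_pd_sub (hS : IsOpen S) (ε : Fin m → ℝ) (A : Fin m)
    (hA : ε A * ε A = 1) (a : ℝ) (k : ℕ) (hf : ContDiffOn ℝ ∞ f S) :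
    Set.EqOn ((lap ε)^[k] fun y => a * pd A f y - ε A * (y A * lap ε f y))
      (fun y => (a - 2 * k) * pd A ((lap ε)^[k] f) y
        - ε A * (y A * (lap ε)^[k + 1] f y)) S := by
  induction k with
  | zero => intro x _; simp
  | succ k ih =>
    intro x hx
    simp only [Function.iterate_succ_apply'] at ih ⊢
    rw [lap_congr hS ε ih hx,
      lap_const_mul_pd_sub hS ε A hA _ (iterate_lap_smoothOn hS ε k hf) hx]
    push_cast
    ring

lemma thomasD_eqOn (hS : IsOpen S) (ε : Fin m → ℝ) (c : ℝ) (A : Fin m) {w : ℝ}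
    (hf : ContDiffOn ℝ ∞ f S) (hom : ∀ y ∈ S, euler f y = w * f y) :
    Set.EqOn (thomasD ε c A f)
      (fun y => (2 * (w - 1 + c)) * pd A f y - ε A * (y A * lap ε f y)) S := fun x hx => by
  simp only [thomasD, euler_pd hS A hf hom x hx]
  ring

lemma thomasD_smoothOn (hS : IsOpen S) (ε : Fin m → ℝ) (c : ℝ) (A : Fin m) {w : ℝ}
    (hf : ContDiffOn ℝ ∞ f S) (hom : ∀ y ∈ S, euler f y = w * f y) :
    ContDiffOn ℝ ∞ (thomasD ε c A f) S :=
  (smoothOn_const_mul_pd_sub hS ε A _ _ hf).congr (thomasD_eqOn hS ε c A hf hom)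

lemma euler_thomasD (hS : IsOpen S) (ε : Fin m → ℝ) (c : ℝ) (A : Fin m) {w : ℝ}
    (hf : ContDiffOn ℝ ∞ f S) (hom : ∀ y ∈ S, euler f y = w * f y) :
    ∀ y ∈ S, euler (thomasD ε c A f) y = (w - 1) * thomasD ε c A f y := fun x hx => by
  have h₁ := differentiableAt_of_smoothOn hS (pd_smoothOn hS A hf) hx
  have h₂ := differentiableAt_of_smoothOn hS (lap_smoothOn hS ε hf) hx
  have h₃ := differentiableAt_of_smoothOn hS (coord_mul_smoothOn A (lap_smoothOn hS ε hf)) hx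
  rw [euler_congr hS (thomasD_eqOn hS ε c A hf hom) hx, thomasD_eqOn hS ε c A hf hom hx,
    euler_sub (h₁.const_mul _) (h₃.const_mul _), euler_const_mul _ h₁, euler_const_mul _ h₃,
    euler_coord_mul A h₂, euler_pd hS A hf hom x hx, euler_lap hS ε hf hom x hx]
  ring

lemma thomasDList_append_singleton (ε : Fin m → ℝ) (c : ℝ) (L : List (Fin m)) (A : Fin m) :
    thomasDList ε c (L ++ [A]) f = thomasDList ε c L (thomasD ε c A f) := by
  induction L with
  | nil => rfl
  | cons B L ih => simp only [List.cons_append, thomasDList, ih]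

theorem thomasDList_eqOn (hS : IsOpen S) (ε : Fin m → ℝ) (hε : ∀ A, ε A * ε A = 1) (c : ℝ)
    (L : List (Fin m)) (hf : ContDiffOn ℝ ∞ f S)
    (hom : ∀ y ∈ S, euler f y = ((L.length : ℝ) - c) * f y) :
    ∀ x ∈ S, thomasDList ε c L f x
      = (-1 : ℝ) ^ L.length * (L.map fun A => ε A * x A).prod * (lap ε)^[L.length] f x := by
  induction L using List.reverseRecOn generalizing f with
  | nil => intro x _; simp [thomasDList]
  | append_singleton L A ih =>
    intro x hx
    have hD := euler_thomasD hS ε c A hf hom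
    rw [thomasDList_append_singleton, ih (thomasD_smoothOn hS ε c A hf hom)
      (fun y hy => by
        rw [hD y hy, List.length_append, List.length_singleton]
        push_cast
        ring) x hx,
      iterate_lap_congr hS ε _ (thomasD_eqOn hS ε c A hf hom) hx,
      iterate_lap_const_mul_pd_sub hS ε A (hε A) _ _ hf hx]
    simp only [List.length_append, List.length_singleton, List.map_append, List.map_cons,
      List.map_nil, List.prod_append, List.prod_singleton]
    push_cast
    ring

end Calculus

/-- for `Φ` smooth on `ℝ^{n+2} ∖ {0}` homogeneous of degree `ℓ - n/2`,
`D_{A₁} ⋯ D_{A_ℓ} Φ = (-1)^ℓ X_{A₁} ⋯ X_{A_ℓ} □^ℓ Φ`. -/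
theorem thomasD_iter_eq_lap_pow
    (n : ℕ) (hn : 1 ≤ n) (ε : Fin (n + 2) → ℝ) (hsig : isSig ε 2)
    (ℓ : ℕ) (hℓ : 1 ≤ ℓ) (Φ : (Fin (n + 2) → ℝ) → ℝ)
    (hΦ : ContDiffOn ℝ (⊤ : ℕ∞) Φ {x | x ≠ 0})
    (hom : ∀ x : Fin (n + 2) → ℝ, x ≠ 0 →
      euler Φ x = ((ℓ : ℝ) - (n : ℝ) / 2) * Φ x)
    (L : List (Fin (n + 2))) (hL : L.length = ℓ) :
    ∀ x : Fin (n + 2) → ℝ, x ≠ 0 →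
      thomasDList ε ((n : ℝ) / 2) L Φ x
        = (-1 : ℝ) ^ ℓ * (L.map fun A => ε A * x A).prod * (lap ε)^[ℓ] Φ x := by
  subst hL
  exact thomasDList_eqOn isOpen_ne ε
    (fun A => by rcases hsig.1 A with h | h <;> simp [h]) _ L hΦ hom

end
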